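/- Let k be an infinite field with char k ≠ 2. Then for every integer m ≥ 2, the sequence (1, C(m+3,3), (m+1)^2, C(m+3,3), 1) is not a Gorenstein h-vector over k: there is no standard graded artinian Gorenstein k-algebra whose Hilbert function is (1, C(m+3,3), (m+1)^2, C(m+3,3), 1). In particular (taking m = 2), (1, 10, 9, 10, 1) is not a Gorenstein h-vector. -/

import Mathlib

open MvPolynomial

/-- The degree-`d` graded component of `R/I` (the image of the space of
degree-`d` homogeneous polynomials in the quotient), as a `k`-submodule. -/
noncomputable def gradedPiece (k : Type*) [Field k] (r : ℕ)
    (I : Ideal (MvPolynomial (Fin r) k)) (d : ℕ) :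
    Submodule k (MvPolynomial (Fin r) k ⧸ I) :=
  Submodule.map (Ideal.Quotient.mkₐ k I).toLinearMap
    (homogeneousSubmodule (Fin r) k d)

/-- The Hilbert function of `R/I` in degree `d`. -/
noncomputable def hilb (k : Type*) [Field k] (r : ℕ)
    (I : Ideal (MvPolynomial (Fin r) k)) (d : ℕ) : ℕ :=
  Module.finrank k (gradedPiece k r I d)

/-- `I` is a homogeneous ideal. -/
def IsHomogIdeal {k : Type*} [Field k] {r : ℕ}
    (I : Ideal (MvPolynomial (Fin r) k)) : Prop :=
  ∀ f ∈ I, ∀ n : ℕ, homogeneousComponent n f ∈ I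

/-- `I` contains no nonzero linear forms. -/
def NoLinearForms {k : Type*} [Field k] {r : ℕ}
    (I : Ideal (MvPolynomial (Fin r) k)) : Prop :=
  ∀ f ∈ I, f.IsHomogeneous 1 → f = 0

/-- The dimension of the degree-`i` component of the socle of `R/I`. -/
noncomputable def socDim (k : Type*) [Field k] (r : ℕ)
    (I : Ideal (MvPolynomial (Fin r) k)) (i : ℕ) : ℕ :=
  Module.finrank k (Submodule.map (Ideal.Quotient.mkₐ k I).toLinearMap
    (homogeneousSubmodule (Fin r) k i ⊓
      ⨅ j : Fin r, Submodule.comap (LinearMap.mulLeft k (X j))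
        (Submodule.restrictScalars k I)))

/-- `R/I` is a standard graded artinian algebra:
`I` is homogeneous and `R/I` is finite-dimensional over `k`. -/
def StdArtinian (k : Type*) [Field k] (r : ℕ)
    (I : Ideal (MvPolynomial (Fin r) k)) : Prop :=
  IsHomogIdeal I ∧ Module.Finite k (MvPolynomial (Fin r) k ⧸ I)

/-- `R/I` has socle degree `e`: `e` is the largest degree with nonzero
Hilbert function. -/
def SocleDegree (k : Type*) [Field k] (r : ℕ)
    (I : Ideal (MvPolynomial (Fin r) k)) (e : ℕ) : Prop :=
  hilb k r I e ≠ 0 ∧ ∀ j : ℕ, e < j → hilb k r I j = 0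

/-- `R/I` is a standard graded artinian Gorenstein algebra of socle degree `e`:
the socle vanishes below degree `e` and is one-dimensional in degree `e`. -/
def Gorenstein (k : Type*) [Field k] (r e : ℕ)
    (I : Ideal (MvPolynomial (Fin r) k)) : Prop :=
  StdArtinian k r I ∧ SocleDegree k r I e ∧
    (∀ i : ℕ, i < e → socDim k r I i = 0) ∧ socDim k r I e = 1

/-- `R/I` is a standard graded artinian level algebra of socle degree `e`. -/
def LevelAlg (k : Type*) [Field k] (r e : ℕ)
    (I : Ideal (MvPolynomial (Fin r) k)) : Prop :=
  StdArtinian k r I ∧ SocleDegree k r I e ∧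
    (∀ i : ℕ, i < e → socDim k r I i = 0)

/-- The linear form with coefficient vector `c`. -/
noncomputable def linForm {k : Type*} [Field k] {r : ℕ} (c : Fin r → k) :
    MvPolynomial (Fin r) k :=
  ∑ i, C (c i) * X i

/-- A property `P` holds for a general linear form: there is a nonempty
(basic) Zariski-open subset of the space of linear forms on which `P` holds. -/
def Generically (k : Type*) [Field k] (r : ℕ)
    (P : MvPolynomial (Fin r) k → Prop) : Prop :=
  ∃ Q : MvPolynomial (Fin r) k, Q ≠ 0 ∧
    ∀ c : Fin r → k, eval c Q ≠ 0 → P (linForm c)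

/-- `R/I` has the weak Lefschetz property (socle degree `e`): multiplication
by some linear form has maximal rank from each degree `i < e` to degree `i+1`. -/
def WLP (k : Type*) [Field k] (r e : ℕ)
    (I : Ideal (MvPolynomial (Fin r) k)) : Prop :=
  ∃ L : MvPolynomial (Fin r) k, L.IsHomogeneous 1 ∧
    ∀ i : ℕ, i < e →
      Module.finrank k (Submodule.map
        (LinearMap.mulLeft k (Ideal.Quotient.mk I L)) (gradedPiece k r I i)) =
      min (hilb k r I i) (hilb k r I (i + 1))

/-- The largest `t` with `choose t i ≤ n`: the leading top in the
`i`-binomial expansion of `n`. -/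
noncomputable def binTop (n i : ℕ) : ℕ := sSup {t : ℕ | Nat.choose t i ≤ n}

/-- Auxiliary recursion computing `((n)_{(i)})⁻¹₀`, i.e. the sum
`C(n_i - 1, i) + C(n_{i-1} - 1, i-1) + ⋯ + C(n_j - 1, j)` where
`n_{(i)} = C(n_i, i) + ⋯ + C(n_j, j)` is the `i`-binomial expansion of `n`. -/
noncomputable def greenBoundAux : ℕ → ℕ → ℕ
  | 0, _ => 0
  | (i + 1), n =>
    if n = 0 then 0 else
      Nat.choose (binTop n (i + 1) - 1) (i + 1) +
        greenBoundAux i (n - Nat.choose (binTop n (i + 1)) (i + 1))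

/-- `greenBound n i = ((n)_{(i)})⁻¹₀`. -/
noncomputable def greenBound (n i : ℕ) : ℕ := greenBoundAux i n

open Module

section GenericRank

variable {k V E F : Type*} [Field k] [AddCommGroup V] [Module k V]
  [AddCommGroup E] [Module k E] [AddCommGroup F] [Module k F]

/-- A cone which meets every line through one of its points in a cofinite set. -/
def LineOpen (k : Type*) {V : Type*} [Field k] [AddCommGroup V] [Module k V] (G : Set V) : Prop :=
  (∀ x ∈ G, ∀ y, {s : k | x + s • y ∉ G}.Finite) ∧ ∀ x ∈ G, ∀ s : k, s ≠ 0 → s • x ∈ G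

theorem LineOpen.inter {G H : Set V} (hG : LineOpen k G) (hH : LineOpen k H) :
    LineOpen k (G ∩ H) := by
  refine ⟨fun x hx y => ((hG.1 x hx.1 y).union (hH.1 x hx.2 y)).subset ?_,
    fun x hx s hs => ⟨hG.2 x hx.1 s hs, hH.2 x hx.2 s hs⟩⟩
  intro s hs
  by_contra hcon
  simp only [Set.mem_union, Set.mem_ofPred_eq, not_or, not_not] at hcon
  exact hs ⟨hcon.1, hcon.2⟩

theorem LineOpen.inter_nonempty [Infinite k] {G H : Set V} (hG : LineOpen k G)
    (hH : LineOpen k H) (nG : G.Nonempty) (nH : H.Nonempty) : (G ∩ H).Nonempty := by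
  obtain ⟨x, hx⟩ := nG
  obtain ⟨y, hy⟩ := nH
  obtain ⟨s, hs⟩ := (((hG.1 x hx y).union
    ((hH.1 y hy x).image (fun t => t⁻¹))).union (Set.finite_singleton (0 : k))).exists_notMem
  simp only [Set.mem_union, Set.mem_ofPred_eq, Set.mem_image, Set.mem_singleton_iff,
    not_or, not_not, not_exists, not_and] at hs
  obtain ⟨⟨h1, h2⟩, h0⟩ := hs
  refine ⟨x + s • y, h1, ?_⟩
  have h3 : y + s⁻¹ • x ∈ H := by
    by_contra hcon
    exact h2 s⁻¹ hcon (inv_inv s)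
  have h4 := hH.2 _ h3 s h0
  rwa [smul_add, smul_smul, mul_inv_cancel₀ h0, one_smul, add_comm] at h4

theorem finite_finrank_range_add_smul_lt [FiniteDimensional k F] (A B : E →ₗ[k] F) :
    {s : k | finrank k (A + s • B).range < finrank k A.range}.Finite := by
  obtain ⟨i, hi⟩ := A.rangeRestrict.exists_rightInverse_of_surjective A.range_rangeRestrict
  obtain ⟨p, hp⟩ := A.range.subtype.exists_leftInverse_of_injective A.range.ker_subtype
  set D : End k A.range := p ∘ₗ B ∘ₗ i with hD
  have hfin : {μ : k | D.HasEigenvalue μ}.Finite := D.finite_hasEigenvalue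
  refine (hfin.image fun μ => -μ⁻¹).subset ?_
  intro s hs
  by_contra hcon
  have hinj : Function.Injective
      ((A + s • B).rangeRestrict ∘ₗ i : A.range →ₗ[k] (A + s • B).range) := by
    rw [← LinearMap.ker_eq_bot, LinearMap.ker_eq_bot']
    intro u hu
    have hu1 : A (i u) + s • B (i u) = 0 := by simpa using congrArg Subtype.val hu
    have hu2 : u + s • D u = 0 := by
      have := congrArg p hu1
      have e1 : A (i u) = A.range.subtype u :=
        congrArg Subtype.val (LinearMap.congr_fun hi u)
      rw [e1, map_add, map_smul, map_zero] at this
      simpa [hD] using (congrArg (· + s • p (B (i u))) (LinearMap.congr_fun hp u)).symm.trans this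
    by_contra hne
    have hs0 : s ≠ 0 := by
      rintro rfl
      exact hne (by simpa using hu2)
    refine hcon ⟨-s⁻¹, ?_, by simp⟩
    refine Module.End.hasEigenvalue_of_hasEigenvector (x := u) ⟨?_, hne⟩
    rw [Module.End.mem_eigenspace_iff]
    have := congrArg (s⁻¹ • ·) hu2
    simp only [smul_add, smul_smul, inv_mul_cancel₀ hs0, one_smul, smul_zero] at this
    rw [neg_smul]
    exact eq_neg_of_add_eq_zero_right this
  exact absurd (LinearMap.finrank_le_finrank_of_injective hinj) (not_le.mpr hs)

theorem finite_finrank_map_add_smul_lt [FiniteDimensional k F] (A B : E →ₗ[k] F)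
    (T : Submodule k E) :
    {s : k | finrank k (T.map (A + s • B)) < finrank k (T.map A)}.Finite := by
  have e : ∀ f : E →ₗ[k] F, finrank k (T.map f) = finrank k (f.domRestrict T).range :=
    fun f => by rw [LinearMap.range_domRestrict]
  simp only [e]
  exact finite_finrank_range_add_smul_lt (A.domRestrict T) (B.domRestrict T)

theorem lineOpen_le_finrank_map [FiniteDimensional k F] (A : V →ₗ[k] E →ₗ[k] F)
    (T : Submodule k E) (n : ℕ) : LineOpen k {x | n ≤ finrank k (T.map (A x))} := by
  refine ⟨fun x hx y => (finite_finrank_map_add_smul_lt (A x) (A y) T).subset ?_, ?_⟩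
  · intro s hs
    have e : A (x + s • y) = A x + s • A y := by rw [map_add, map_smul]
    simp only [Set.mem_ofPred_eq, not_le] at hs ⊢
    rw [← e]
    exact hs.trans_le hx
  · intro x hx s hs
    rw [Set.mem_ofPred_eq, map_smul, Submodule.map_smul _ _ _ hs]
    exact hx

theorem map_ker_le_map_of_finrank_le [Infinite k] [FiniteDimensional k F] (A B : E →ₗ[k] F)
    (T : Submodule k E) (h : ∀ s : k, finrank k (T.map (A + s • B)) ≤ finrank k (T.map A)) :
    (T ⊓ A.ker).map B ≤ T.map A := by
  rintro _ ⟨x, ⟨hxT, hxA⟩, rfl⟩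
  by_contra hB
  let A' : T × k →ₗ[k] F := (A.domRestrict T).coprod (LinearMap.toSpanSingleton k F (B x))
  let B' : T × k →ₗ[k] F := (B.domRestrict T).coprod 0
  have hA' : A'.range = T.map A ⊔ k ∙ B x := by
    rw [LinearMap.range_coprod, LinearMap.range_domRestrict, LinearMap.range_toSpanSingleton]
  obtain ⟨s, hs⟩ := ((finite_finrank_range_add_smul_lt A' B').union
    (Set.finite_singleton (0 : k))).exists_notMem
  simp only [Set.mem_union, Set.mem_ofPred_eq, Set.mem_singleton_iff, not_or, not_lt] at hs
  obtain ⟨h1, h0⟩ := hs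
  have h2 : (A' + s • B').range ≤ T.map (A + s • B) := by
    rintro _ ⟨⟨t, c⟩, rfl⟩
    refine ⟨t + (c * s⁻¹) • x, T.add_mem t.2 (T.smul_mem _ hxT), ?_⟩
    have : A x = 0 := hxA
    simp [A', B', this, smul_smul, mul_comm c, mul_inv_cancel_left₀ h0]
    abel
  have h3 : T.map A < A'.range := by
    rw [hA']
    refine lt_of_le_of_ne le_sup_left fun he => hB ?_
    rw [he]
    exact Submodule.mem_sup_right (Submodule.mem_span_singleton_self _)
  have := Submodule.finrank_lt_finrank_of_lt h3
  have := Submodule.finrank_mono h2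
  have := h s
  omega

omit [AddCommGroup V] [Module k V] in
theorem exists_forall_finrank_map_le [FiniteDimensional k F] (A : V → E →ₗ[k] F)
    (T : Submodule k E) [Nonempty V] :
    ∃ x, ∀ y, finrank k (T.map (A y)) ≤ finrank k (T.map (A x)) := by
  have hb : BddAbove (Set.range fun x => finrank k (T.map (A x))) :=
    ⟨finrank k F, by rintro _ ⟨x, rfl⟩; exact Submodule.finrank_le _⟩
  obtain ⟨x, hx⟩ := Nat.sSup_mem (Set.range_nonempty _) hb
  exact ⟨x, fun y => by
    have h1 := le_csSup hb (Set.mem_range_self y)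
    rw [← hx] at h1
    exact h1⟩

theorem finrank_map_add_finrank_inf_ker [FiniteDimensional k E] (A : E →ₗ[k] F)
    (T : Submodule k E) :
    finrank k (T.map A) + finrank k (T ⊓ A.ker : Submodule k E) = finrank k T := by
  have h := LinearMap.finrank_range_add_finrank_ker (A.domRestrict T)
  rw [LinearMap.range_domRestrict] at h
  have e : (A.domRestrict T).ker.map T.subtype = T ⊓ A.ker := by
    ext x
    simp [LinearMap.mem_ker, and_comm]
  rw [← h, ← e, Submodule.finrank_map_subtype_eq]

end GenericRank

section Contraction

variable {k V W E : Type*} [Field k] [Infinite k] [AddCommGroup V] [Module k V]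
  [FiniteDimensional k V] [AddCommGroup W] [Module k W] [FiniteDimensional k W]
  [AddCommGroup E] [Module k E] [FiniteDimensional k E]

omit [Infinite k] [FiniteDimensional k V] [FiniteDimensional k W] in
theorem lineOpen_apply_self_ne_zero (q : V →ₗ[k] V →ₗ[k] k) :
    LineOpen k {x | q x x ≠ 0} := by
  refine ⟨fun x hx y => ?_, fun x hx s hs => by simpa [hs] using hx⟩
  let P : Polynomial k := Polynomial.C (q x x) + Polynomial.C (q x y + q y x) * Polynomial.X +
    Polynomial.C (q y y) * Polynomial.X ^ 2
  have hP : P ≠ 0 := by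
    intro h
    apply hx
    simpa [P] using congrArg (Polynomial.eval 0) h
  refine (Polynomial.finite_setOfPred_isRoot hP).subset ?_
  intro s hs
  simp only [Set.mem_ofPred_eq, not_not] at hs
  simp only [Set.mem_ofPred_eq, Polynomial.IsRoot.def]
  simp only [map_add, LinearMap.add_apply, map_smul, LinearMap.smul_apply, smul_eq_mul] at hs
  simp only [P, Polynomial.eval_add, Polynomial.eval_mul, Polynomial.eval_C, Polynomial.eval_X,
    Polynomial.eval_pow]
  linear_combination hs

/-- A space `Q` of symmetric bilinear forms all of whose contractions have dimension at most `e`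
has dimension at most `C(e+1,2)`. -/
theorem finrank_le_of_finrank_contraction_le (h2 : (2 : k) ≠ 0)
    (ι : V →ₗ[k] W →ₗ[k] (V →ₗ[k] k)) (hsymm : ∀ x w y, ι x w y = ι y w x)
    (hinj : ∀ w, (∀ x, ι x w = 0) → w = 0) (e : ℕ) (Q : Submodule k W)
    (hQ : ∀ x, finrank k (Q.map (ι x)) ≤ e) : finrank k Q ≤ (e + 1).choose 2 := by
  induction e generalizing Q with
  | zero =>
    have : Q = ⊥ := by
      rw [eq_bot_iff]
      intro q hq
      refine hinj q fun x => ?_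
      have h0 := hQ x
      rw [Nat.le_zero, Submodule.finrank_eq_zero] at h0
      have : ι x q ∈ Q.map (ι x) := Submodule.mem_map_of_mem hq
      rwa [h0, Submodule.mem_bot] at this
    rw [this, finrank_bot]
    exact Nat.zero_le _
  | succ e ih =>
    by_cases hQ0 : Q = ⊥
    · rw [hQ0, finrank_bot]
      exact Nat.zero_le _
    obtain ⟨q, hq, hq0⟩ := Q.ne_bot_iff.mp hQ0
    have hx0 : ({x | ι.flip q x x ≠ 0} : Set V).Nonempty := by
      by_contra hcon
      replace hcon : ∀ x, ι x q x = 0 := fun x => by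
        by_contra h
        exact hcon ⟨x, h⟩
      refine hq0 (hinj q fun x => LinearMap.ext fun y => ?_)
      have h1 := hcon (x + y)
      simp only [map_add, LinearMap.add_apply] at h1
      rw [hcon x, hcon y,
        hsymm y q x, zero_add, add_zero, ← two_mul] at h1
      exact (mul_eq_zero.mp h1).resolve_left h2
    obtain ⟨x₀, hx₀⟩ := exists_forall_finrank_map_le (fun x => ι x) Q
    obtain ⟨x, hx1, hx2⟩ := (lineOpen_apply_self_ne_zero (ι.flip q)).inter_nonempty
      (lineOpen_le_finrank_map ι Q (finrank k (Q.map (ι x₀)))) hx0 ⟨x₀, le_refl (finrank k _)⟩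
    have hmax : ∀ y, finrank k (Q.map (ι y)) ≤ finrank k (Q.map (ι x)) :=
      fun y => (hx₀ y).trans hx2
    have hlt : Q.map (ι x) ⊓ (LinearMap.applyₗ x : (V →ₗ[k] k) →ₗ[k] k).ker < Q.map (ι x) := by
      refine lt_of_le_of_ne inf_le_left fun he => hx1 ?_
      have : ι x q ∈ Q.map (ι x) := Submodule.mem_map_of_mem hq
      rw [← he] at this
      exact this.2
    have h3 := ih (Q ⊓ (ι x).ker) fun y => by
      have hle : (Q ⊓ (ι x).ker).map (ι y) ≤
          Q.map (ι x) ⊓ (LinearMap.applyₗ x : (V →ₗ[k] k) →ₗ[k] k).ker := by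
        refine le_inf (map_ker_le_map_of_finrank_le (ι x) (ι y) Q fun s => ?_) ?_
        · rw [← map_smul, ← map_add]
          exact hmax _
        · rintro _ ⟨p, ⟨-, hp⟩, rfl⟩
          have hp' : ι x p = 0 := hp
          simp [LinearMap.mem_ker, hsymm y p x, hp']
      have := Submodule.finrank_mono hle
      have := Submodule.finrank_lt_finrank_of_lt hlt
      have := hQ x
      omega
    have h4 := finrank_map_add_finrank_inf_ker (ι x) Q
    have h5 : (e + 1 + 1).choose 2 = (e + 1) + (e + 1).choose 2 := by
      rw [Nat.choose_succ_succ' (e + 1) 1, Nat.choose_one_right]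
    have := hQ x
    omega

omit [FiniteDimensional k E] in
/-- If the largest contraction of a space `T` of symmetric trilinear forms has dimension
`f > C(t,2)`, then for some `x` it has dimension `f` while the forms of `T` killed by `x` have all
contractions of dimension at most `f - t`. -/
theorem exists_finrank_contraction_ker_add_le (h2 : (2 : k) ≠ 0)
    (ι : V →ₗ[k] W →ₗ[k] (V →ₗ[k] k)) (hsymm : ∀ x w y, ι x w y = ι y w x)
    (hinj : ∀ w, (∀ x, ι x w = 0) → w = 0)
    (g : V →ₗ[k] E →ₗ[k] W) (hg : ∀ x y a, ι x (g y a) = ι y (g x a))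
    (T : Submodule k E) (t f : ℕ) (hf : t.choose 2 < f) (x₂ : V)
    (hx₂ : finrank k (T.map (g x₂)) = f) (hmax : ∀ x, finrank k (T.map (g x)) ≤ f) :
    ∃ x, finrank k (T.map (g x)) = f ∧
      ∀ y, finrank k ((T ⊓ (g x).ker).map (g y)) + t ≤ f := by
  obtain ⟨z, hz⟩ := exists_forall_finrank_map_le (fun x => ι x) (T.map (g x₂))
  have hzt : t ≤ finrank k ((T.map (g x₂)).map (ι z)) := by
    by_contra hcon
    cases t with
    | zero => exact hcon (Nat.zero_le _)
    | succ t =>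
      have := finrank_le_of_finrank_contraction_le h2 ι hsymm hinj t (T.map (g x₂))
        fun x => (hz x).trans (by omega)
      omega
  obtain ⟨x₁, h1, h1'⟩ := (lineOpen_le_finrank_map g T f).inter_nonempty
    (lineOpen_le_finrank_map ι (T.map (g x₂)) t) ⟨x₂, hx₂.ge⟩ ⟨z, hzt⟩
  refine ⟨x₁, le_antisymm (hmax x₁) h1, ?_⟩
  let g' : V →ₗ[k] E →ₗ[k] (V →ₗ[k] k) := (LinearMap.llcomp k E W (V →ₗ[k] k) (ι x₁)) ∘ₗ g
  have hg' : ∀ x, T.map (g' x) = (T.map (g x)).map (ι x₁) := fun x => by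
    rw [← Submodule.map_comp]; rfl
  obtain ⟨w, hw⟩ := exists_forall_finrank_map_le (fun x => g x) (T ⊓ (g x₁).ker)
  obtain ⟨y, ⟨hy1, hy2⟩, hy3⟩ := ((lineOpen_le_finrank_map g T f).inter
    (lineOpen_le_finrank_map g' T t)).inter_nonempty
    (lineOpen_le_finrank_map g (T ⊓ (g x₁).ker) (finrank k ((T ⊓ (g x₁).ker).map (g w))))
    ⟨x₂, hx₂.ge, by rw [Set.mem_ofPred_eq, hg']; exact h1'⟩ ⟨w, le_refl (finrank k _)⟩
  simp only [Set.mem_ofPred_eq] at hy1 hy2 hy3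
  rw [hg'] at hy2
  have h6 := finrank_map_add_finrank_inf_ker (ι x₁) (T.map (g y))
  have h7 : (T ⊓ (g x₁).ker).map (g y) ≤ T.map (g y) ⊓ (ι x₁).ker := by
    refine le_inf (Submodule.map_mono inf_le_left) ?_
    rintro _ ⟨a, ⟨-, ha⟩, rfl⟩
    have ha' : g x₁ a = 0 := ha
    rw [LinearMap.mem_ker, hg, ha', map_zero]
  have h8 := Submodule.finrank_mono h7
  have h9 := hmax y
  intro x
  have h10 : finrank k ((T ⊓ (g x₁).ker).map (g x)) ≤ _ := hw x
  omega

/-- A space `T` of symmetric trilinear forms all of whose contractions have dimension at most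
`p ≤ C(t+1,2)` has dimension at most `p + C(t+1,3)`. -/
theorem finrank_le_of_finrank_contraction_le_choose (h2 : (2 : k) ≠ 0)
    (ι : V →ₗ[k] W →ₗ[k] (V →ₗ[k] k)) (hsymm : ∀ x w y, ι x w y = ι y w x)
    (hinj : ∀ w, (∀ x, ι x w = 0) → w = 0)
    (g : V →ₗ[k] E →ₗ[k] W) (hg : ∀ x y a, ι x (g y a) = ι y (g x a))
    (ginj : ∀ a, (∀ x, g x a = 0) → a = 0) (t p : ℕ) (hp : p ≤ (t + 1).choose 2)
    (T : Submodule k E) (hT : ∀ x, finrank k (T.map (g x)) ≤ p) :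
    finrank k T ≤ p + (t + 1).choose 3 := by
  induction t generalizing p T with
  | zero =>
    have : T = ⊥ := by
      rw [eq_bot_iff]
      intro a ha
      refine ginj a fun x => ?_
      have h0 := hT x
      obtain rfl : p = 0 := by simpa using hp
      rw [Nat.le_zero, Submodule.finrank_eq_zero] at h0
      have : g x a ∈ T.map (g x) := Submodule.mem_map_of_mem ha
      rwa [h0, Submodule.mem_bot] at this
    rw [this, finrank_bot]
    exact Nat.zero_le _
  | succ t ih =>
    have c3 : (t + 1 + 1).choose 3 = (t + 1).choose 2 + (t + 1).choose 3 :=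
      Nat.choose_succ_succ' (t + 1) 2
    have c2 : (t + 1 + 1).choose 2 = (t + 1) + (t + 1).choose 2 := by
      rw [Nat.choose_succ_succ' (t + 1) 1, Nat.choose_one_right]
    obtain ⟨x₂, hx₂⟩ := exists_forall_finrank_map_le (fun x => g x) T
    obtain ⟨f, hf⟩ : ∃ f, finrank k (T.map (g x₂)) = f := ⟨_, rfl⟩
    simp only [hf] at hx₂
    have hfp : f ≤ p := hf ▸ hT x₂
    by_cases hft : f ≤ (t + 1).choose 2
    · have := ih f hft T hx₂
      omega
    push Not at hft
    obtain ⟨x₁, h1, h1'⟩ := exists_finrank_contraction_ker_add_le h2 ι hsymm hinj g hg T (t + 1) f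
      hft x₂ hf hx₂
    have h3 := ih (f - (t + 1)) (by omega) (T ⊓ (g x₁).ker) fun x => by
      have := h1' x
      omega
    have h4 := finrank_map_add_finrank_inf_ker (g x₁) T
    omega

/-- Strict form of `finrank_le_of_finrank_contraction_le_choose`. -/
theorem finrank_lt_of_finrank_contraction_lt_choose (h2 : (2 : k) ≠ 0)
    (ι : V →ₗ[k] W →ₗ[k] (V →ₗ[k] k)) (hsymm : ∀ x w y, ι x w y = ι y w x)
    (hinj : ∀ w, (∀ x, ι x w = 0) → w = 0)
    (g : V →ₗ[k] E →ₗ[k] W) (hg : ∀ x y a, ι x (g y a) = ι y (g x a))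
    (ginj : ∀ a, (∀ x, g x a = 0) → a = 0) (t p : ℕ) (ht : 2 ≤ t) (hp : p < (t + 1).choose 2)
    (T : Submodule k E) (hT : ∀ x, finrank k (T.map (g x)) ≤ p) :
    finrank k T < p + (t + 1).choose 3 := by
  obtain ⟨t, rfl⟩ : ∃ u, t = u + 1 := ⟨t - 1, by omega⟩
  have c3 : (t + 1 + 1).choose 3 = (t + 1).choose 2 + (t + 1).choose 3 :=
    Nat.choose_succ_succ' (t + 1) 2
  have c2 : (t + 1 + 1).choose 2 = (t + 1) + (t + 1).choose 2 := by
    rw [Nat.choose_succ_succ' (t + 1) 1, Nat.choose_one_right]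
  have cpos : 0 < (t + 1).choose 2 := Nat.choose_pos ht
  obtain ⟨x₂, hx₂⟩ := exists_forall_finrank_map_le (fun x => g x) T
  obtain ⟨f, hf⟩ : ∃ f, finrank k (T.map (g x₂)) = f := ⟨_, rfl⟩
  simp only [hf] at hx₂
  have hfp : f ≤ p := hf ▸ hT x₂
  by_cases hft : f ≤ (t + 1).choose 2
  · have := finrank_le_of_finrank_contraction_le_choose h2 ι hsymm hinj g hg ginj t f hft T hx₂
    omega
  push Not at hft
  obtain ⟨x₁, h1, h1'⟩ := exists_finrank_contraction_ker_add_le h2 ι hsymm hinj g hg T (t + 1) f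
    hft x₂ hf hx₂
  have h3 := finrank_le_of_finrank_contraction_le_choose h2 ι hsymm hinj g hg ginj t (f - (t + 1))
    (by omega) (T ⊓ (g x₁).ker) fun x => by
      have := h1' x
      omega
  have h4 := finrank_map_add_finrank_inf_ker (g x₁) T
  omega

end Contraction

section MiddleCatalecticant

variable {k V W : Type*} [Field k] [Infinite k] [AddCommGroup V] [Module k V]
  [FiniteDimensional k V] [AddCommGroup W] [Module k W] [FiniteDimensional k W]

/-- The components of degree one and two of a Gorenstein algebra of socle degree four cannot have
dimensions `C(m+3,3)` and `(m+1)²`. Here `μ` is the multiplication and `B` the pairing of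
degree two with itself. -/
theorem false_of_finrank_eq_choose_of_finrank_eq_sq (h2 : (2 : k) ≠ 0)
    (μ : V →ₗ[k] V →ₗ[k] W) (B : W →ₗ[k] W →ₗ[k] k)
    (μcomm : ∀ x y, μ x y = μ y x) (Bcomm : ∀ a b, B a b = B b a)
    (Bμ : ∀ x y z w, B (μ x y) (μ z w) = B (μ x z) (μ y w))
    (Binj : ∀ a, (∀ x y, B a (μ x y) = 0) → a = 0)
    (μinj : ∀ x, (∀ y, μ y x = 0) → x = 0)
    (m : ℕ) (hm : 2 ≤ m) (hV : finrank k V = (m + 3).choose 3)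
    (hW : finrank k W = (m + 1) ^ 2) : False := by
  let ι : V →ₗ[k] W →ₗ[k] (V →ₗ[k] k) :=
    { toFun := fun x => LinearMap.lcomp k k (μ x) ∘ₗ B
      map_add' := fun x y => by ext; simp
      map_smul' := fun c x => by ext; simp }
  have hι : ∀ x a y, ι x a y = B a (μ x y) := fun x a y => rfl
  have ιsymm : ∀ x w y, ι x w y = ι y w x := fun x w y => by rw [hι, hι, μcomm]
  have ιinj : ∀ w, (∀ x, ι x w = 0) → w = 0 := fun w hw => Binj w fun x y => by
    rw [← hι, hw, LinearMap.zero_apply]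
  have ιμ : ∀ x y a, ι x (μ y a) = ι y (μ x a) := fun x y a => by
    ext z
    rw [hι, hι, μcomm y a, μcomm x a, Bμ, Bμ a x, Bcomm, Bμ]
  have ker : LinearMap.ker B = ⊥ := by
    rw [LinearMap.ker_eq_bot']
    intro a ha
    exact Binj a fun x y => by rw [ha, LinearMap.zero_apply]
  have orth : ∀ U : Submodule k W, finrank k U + finrank k (LinearMap.BilinForm.orthogonal B U) =
      finrank k W := fun U => by
    rw [LinearMap.BilinForm.finrank_add_finrank_orthogonal', ker, inf_bot_eq, finrank_bot, add_zero]
  -- binomial coefficients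
  obtain ⟨m, rfl⟩ : ∃ u, m = u + 1 := ⟨m - 1, by omega⟩
  have p1 : (m + 1 + 3).choose 3 = (m + 3).choose 2 + (m + 3).choose 3 :=
    Nat.choose_succ_succ' (m + 3) 2
  have p2 : (m + 3).choose 3 = (m + 2).choose 2 + (m + 2).choose 3 :=
    Nat.choose_succ_succ' (m + 2) 2
  have q1 : (m + 3).choose 2 = (m + 2) + (m + 2).choose 2 := by
    rw [Nat.choose_succ_succ' (m + 2) 1, Nat.choose_one_right]
  have q2 : (m + 2).choose 2 = (m + 1) + (m + 1).choose 2 := by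
    rw [Nat.choose_succ_succ' (m + 1) 1, Nat.choose_one_right]
  have q3 : 2 * (m + 2).choose 2 = (m + 2) * (m + 1) := by
    rw [Nat.choose_two_right, Nat.mul_div_cancel' (Nat.even_mul_pred_self _).two_dvd]
    rfl
  have sq : (m + 1 + 1) ^ 2 = (m + 3).choose 2 + (m + 2).choose 2 := by
    rw [q1]; nlinarith
  -- the orthogonal complement `N x` of `xV`
  set N : V → Submodule k W := fun x => LinearMap.BilinForm.orthogonal B (μ x).range with hN
  have memN : ∀ x a, a ∈ N x ↔ ∀ y, B (μ x y) a = 0 := fun x a => by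
    simp [hN, LinearMap.BilinForm.mem_orthogonal_iff]
  have mapN : ∀ x y, ((⊤ ⊓ (μ x).ker : Submodule k V)).map (μ y) ≤ N x := by
    rintro x y _ ⟨z, ⟨-, hz⟩, rfl⟩
    have hz' : μ x z = 0 := hz
    rw [memN]
    intro w
    rw [μcomm y z, Bμ, hz', map_zero, LinearMap.zero_apply]
  have finN : ∀ x, finrank k ((⊤ : Submodule k V).map (μ x)) + finrank k (N x) = finrank k W :=
    fun x => by rw [← LinearMap.range_eq_map]; exact orth _
  obtain ⟨L₀, hL₀⟩ := exists_forall_finrank_map_le (fun x => μ x) (⊤ : Submodule k V)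
  obtain ⟨b, hb⟩ : ∃ b, finrank k ((⊤ : Submodule k V).map (μ L₀)) = b := ⟨_, rfl⟩
  simp only [hb] at hL₀
  have hker : ∀ x, finrank k ((⊤ : Submodule k V).map (μ x)) = b →
      b + finrank k (⊤ ⊓ (μ x).ker : Submodule k V) = finrank k V := fun x hx => by
    rw [← hx, finrank_map_add_finrank_inf_ker, finrank_top]
  have hblow : (m + 3).choose 2 ≤ b := by
    by_contra hcon
    have : _ ≤ b + (m + 3).choose 3 :=
      finrank_le_of_finrank_contraction_le_choose h2 ι ιsymm ιinj μ ιμ μinj (m + 2) b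
        (show b ≤ (m + 3).choose 2 by omega) ⊤ hL₀
    rw [finrank_top] at this
    omega
  have hbup : b ≤ (m + 3).choose 2 := by
    by_contra hcon
    have h1 := finN L₀
    have : _ < finrank k (N L₀) + (m + 2).choose 3 :=
      finrank_lt_of_finrank_contraction_lt_choose h2 ι ιsymm ιinj μ ιμ μinj (m + 1)
        (finrank k (N L₀)) (by omega) (show _ < (m + 2).choose 2 by omega) (⊤ ⊓ (μ L₀).ker)
        fun y => Submodule.finrank_mono (mapN L₀ y)
    have := hker L₀ hb
    omega
  obtain rfl : b = (m + 3).choose 2 := le_antisymm hbup hblow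
  have finN' : ∀ x, finrank k ((⊤ : Submodule k V).map (μ x)) = (m + 3).choose 2 →
      finrank k (N x) = (m + 2).choose 2 := fun x hx => by
    have := finN x
    omega
  have surj : ∀ x, finrank k ((⊤ : Submodule k V).map (μ x)) = (m + 3).choose 2 →
      ∃ y, (m + 2).choose 2 ≤ finrank k ((⊤ ⊓ (μ x).ker : Submodule k V).map (μ y)) := by
    intro x hx
    by_contra! hcon
    have : _ ≤ (m + 2).choose 2 - 1 + (m + 2).choose 3 :=
      finrank_le_of_finrank_contraction_le_choose h2 ι ιsymm ιinj μ ιμ μinj (m + 1)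
        ((m + 2).choose 2 - 1) (Nat.sub_le _ _) (⊤ ⊓ (μ x).ker)
        fun y => Nat.le_sub_one_of_lt (hcon y)
    have := hker x hx
    omega
  have eqN : ∀ x, finrank k ((⊤ : Submodule k V).map (μ x)) = (m + 3).choose 2 → ∀ y,
      (m + 2).choose 2 ≤ finrank k ((⊤ ⊓ (μ x).ker : Submodule k V).map (μ y)) →
      N x = (⊤ ⊓ (μ x).ker : Submodule k V).map (μ y) := fun x hx y hy =>
    (Submodule.eq_of_le_of_finrank_le (mapN x y) (by rw [finN' x hx]; exact hy)).symm
  have leN : ∀ x, finrank k ((⊤ : Submodule k V).map (μ x)) = (m + 3).choose 2 →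
      N x ≤ (μ x).range := by
    intro x hx
    obtain ⟨y, hy⟩ := surj x hx
    rw [eqN x hx y hy, LinearMap.range_eq_map]
    refine map_ker_le_map_of_finrank_le (μ x) (μ y) ⊤ fun s => ?_
    rw [hx, ← map_smul, ← map_add]
    exact hL₀ _
  obtain ⟨y₀, hy₀⟩ := surj L₀ hb
  obtain ⟨z₀, hz₀⟩ : ∃ z, m + 1 ≤ finrank k ((N L₀).map (ι z)) := by
    by_contra! hcon
    have := finrank_le_of_finrank_contraction_le h2 ι ιsymm ιinj m (N L₀)
      fun x => Nat.lt_succ_iff.mp (hcon x)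
    rw [finN' L₀ hb] at this
    omega
  obtain ⟨M, ⟨hM1, hM2⟩, hM3⟩ :=
    ((lineOpen_le_finrank_map μ ⊤ ((m + 3).choose 2)).inter
      (lineOpen_le_finrank_map μ (⊤ ⊓ (μ L₀).ker) ((m + 2).choose 2))).inter_nonempty
      (lineOpen_le_finrank_map ι (N L₀) (m + 1))
      ((lineOpen_le_finrank_map μ ⊤ ((m + 3).choose 2)).inter_nonempty
        (lineOpen_le_finrank_map μ (⊤ ⊓ (μ L₀).ker) ((m + 2).choose 2))
        ⟨L₀, hb.ge⟩ ⟨y₀, hy₀⟩) ⟨z₀, hz₀⟩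
  simp only [Set.mem_ofPred_eq] at hM1 hM2 hM3
  have hM : finrank k ((⊤ : Submodule k V).map (μ M)) = (m + 3).choose 2 :=
    le_antisymm (hL₀ M) hM1
  have hLM : N L₀ ≤ (μ M).range := by
    rw [eqN L₀ hb M hM2]
    exact LinearMap.map_le_range
  have isot : ∀ x y, N x ≤ (μ y).range → ∀ a ∈ N x, ∀ c ∈ N y, B a c = 0 := by
    intro x y hxy a ha c hc
    obtain ⟨w, rfl⟩ := hxy ha
    exact (memN y c).mp hc w
  have isotS : N L₀ ⊔ N M ≤ LinearMap.BilinForm.orthogonal B (N L₀ ⊔ N M) := by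
    intro c hc
    rw [LinearMap.BilinForm.mem_orthogonal_iff]
    intro a ha
    obtain ⟨a1, ha1, a2, ha2, rfl⟩ := Submodule.mem_sup.mp ha
    obtain ⟨c1, hc1, c2, hc2, rfl⟩ := Submodule.mem_sup.mp hc
    simp only [map_add, LinearMap.add_apply]
    rw [isot L₀ L₀ (leN L₀ hb) a1 ha1 c1 hc1, isot L₀ M hLM a1 ha1 c2 hc2,
      Bcomm a2 c1, isot L₀ M hLM c1 hc1 a2 ha2, isot M M (leN M hM) a2 ha2 c2 hc2]
    simp
  have hinf : N L₀ ⊓ N M ≤ N L₀ ⊓ (ι M).ker := by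
    refine le_inf inf_le_left fun a ha => ?_
    rw [LinearMap.mem_ker]
    ext w
    rw [hι, Bcomm]
    exact (memN M a).mp ha.2 w
  have r1 := Submodule.finrank_mono isotS
  have r2 := orth (N L₀ ⊔ N M)
  have r3 := Submodule.finrank_sup_add_finrank_inf_eq (N L₀) (N M)
  have r4 := Submodule.finrank_mono hinf
  have r5 := finrank_map_add_finrank_inf_ker (ι M) (N L₀)
  rw [finN' L₀ hb] at r3 r5
  rw [finN' M hM] at r3
  have : (m + 1) * m = 2 * (m + 1).choose 2 := by linarith
  nlinarith

end MiddleCatalecticant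

section GradedPieces

variable {k : Type*} [Field k] {r : ℕ} {I : Ideal (MvPolynomial (Fin r) k)}

theorem mul_mem_gradedPiece {i j : ℕ} {a b : MvPolynomial (Fin r) k ⧸ I}
    (ha : a ∈ gradedPiece k r I i) (hb : b ∈ gradedPiece k r I j) :
    a * b ∈ gradedPiece k r I (i + j) := by
  obtain ⟨p, hp, rfl⟩ := ha
  obtain ⟨q, hq, rfl⟩ := hb
  exact ⟨p * q, MvPolynomial.IsHomogeneous.mul hp hq, map_mul (Ideal.Quotient.mkₐ k I) p q⟩

theorem eq_zero_of_socDim_eq_zero [Module.Finite k (MvPolynomial (Fin r) k ⧸ I)] {i : ℕ}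
    (hs : socDim k r I i = 0) {a : MvPolynomial (Fin r) k ⧸ I} (ha : a ∈ gradedPiece k r I i)
    (h : ∀ y ∈ gradedPiece k r I 1, y * a = 0) : a = 0 := by
  obtain ⟨p, hp, rfl⟩ := ha
  rw [socDim, Submodule.finrank_eq_zero, Submodule.eq_bot_iff] at hs
  refine hs _ (Submodule.mem_map_of_mem ⟨hp, ?_⟩)
  simp only [SetLike.mem_coe, Submodule.mem_iInf, Submodule.mem_comap,
    Submodule.restrictScalars_mem, LinearMap.mulLeft_apply]
  intro j
  rw [← Ideal.Quotient.eq_zero_iff_mem, map_mul]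
  exact h _ (Submodule.mem_map_of_mem (isHomogeneous_X k j))

theorem not_gorenstein_of_hilb_eq [Infinite k] (hchar : (2 : k) ≠ 0) {m : ℕ} (hm : 2 ≤ m)
    (hI : Gorenstein k r 4 I) (h1 : hilb k r I 1 = (m + 3).choose 3)
    (h2 : hilb k r I 2 = (m + 1) ^ 2) (h4 : hilb k r I 4 = 1) : False := by
  obtain ⟨⟨-, hfin⟩, -, hsoc, -⟩ := hI
  have zero_of : ∀ {i : ℕ}, i < 4 → ∀ {a}, a ∈ gradedPiece k r I i →
      (∀ y ∈ gradedPiece k r I 1, y * a = 0) → a = 0 :=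
    fun hi _ ha h => eq_zero_of_socDim_eq_zero (hsoc _ hi) ha h
  obtain ⟨ψ, hψ⟩ : ∃ ψ : (MvPolynomial (Fin r) k ⧸ I) →ₗ[k] k,
      ∀ a ∈ gradedPiece k r I 4, ψ a = 0 → a = 0 := by
    let e : gradedPiece k r I 4 ≃ₗ[k] k :=
      LinearEquiv.ofFinrankEq _ _ (h4.trans (finrank_self k).symm)
    obtain ⟨ψ, hψ⟩ := LinearMap.exists_extend (e : gradedPiece k r I 4 →ₗ[k] k)
    refine ⟨ψ, fun a ha h0 => ?_⟩
    have : e ⟨a, ha⟩ = 0 := (LinearMap.congr_fun hψ ⟨a, ha⟩).symm.trans h0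
    exact congrArg Subtype.val (e.map_eq_zero_iff.mp this)
  let μ : gradedPiece k r I 1 →ₗ[k] gradedPiece k r I 1 →ₗ[k] gradedPiece k r I 2 :=
    LinearMap.mk₂ k (fun x y => ⟨x * y, mul_mem_gradedPiece x.2 y.2⟩)
      (fun x y z => Subtype.ext (add_mul _ _ _)) (fun c x y => Subtype.ext (smul_mul_assoc _ _ _))
      (fun x y z => Subtype.ext (mul_add _ _ _)) (fun c x y => Subtype.ext (mul_smul_comm _ _ _))
  let B : gradedPiece k r I 2 →ₗ[k] gradedPiece k r I 2 →ₗ[k] k :=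
    ((LinearMap.mul k (MvPolynomial (Fin r) k ⧸ I)).compr₂ ψ).domRestrict₁₂ _ _
  have hμ : ∀ x y, (μ x y : MvPolynomial (Fin r) k ⧸ I) = x * y := fun _ _ => rfl
  have hB : ∀ a b, B a b = ψ (a * b) := fun _ _ => rfl
  refine false_of_finrank_eq_choose_of_finrank_eq_sq hchar μ B
    (fun x y => Subtype.ext (mul_comm _ _)) (fun a b => by rw [hB, hB, mul_comm])
    (fun x y z w => by rw [hB, hB, hμ, hμ, hμ, hμ, mul_mul_mul_comm]) ?_ ?_ m hm h1 h2
  · intro a ha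
    refine Subtype.ext (zero_of (by norm_num) a.2 fun x hx => ?_)
    have hxa : x * a ∈ gradedPiece k r I 3 := mul_mem_gradedPiece hx a.2
    refine zero_of (by norm_num) hxa fun y hy => hψ _ (mul_mem_gradedPiece hy hxa) ?_
    have := ha ⟨y, hy⟩ ⟨x, hx⟩
    rwa [hB, hμ, mul_comm, mul_assoc] at this
  · intro x hx
    exact Subtype.ext (zero_of (by norm_num) x.2 fun y hy =>
      congrArg Subtype.val (hx ⟨y, hy⟩))

end GradedPieces

/-- **Theorem 3.1.** Assume `char k ≠ 2`. For every `m ≥ 2`, the sequence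
`(1, C(m+3,3), (m+1)², C(m+3,3), 1)` is not a Gorenstein `h`-vector over `k`.
In particular (for `m = 2`), `(1, 10, 9, 10, 1)` is not a Gorenstein
`h`-vector. -/
theorem not_gorenstein_h_vector
    (k : Type*) [Field k] [Infinite k] (hchar : (2 : k) ≠ 0) :
    (∀ m : ℕ, 2 ≤ m →
      ¬ ∃ (r : ℕ) (I : Ideal (MvPolynomial (Fin r) k)),
        NoLinearForms I ∧ Gorenstein k r 4 I ∧
        hilb k r I 0 = 1 ∧ hilb k r I 1 = Nat.choose (m + 3) 3 ∧
        hilb k r I 2 = (m + 1) ^ 2 ∧ hilb k r I 3 = Nat.choose (m + 3) 3 ∧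
        hilb k r I 4 = 1) ∧
    ¬ ∃ (r : ℕ) (I : Ideal (MvPolynomial (Fin r) k)),
        NoLinearForms I ∧ Gorenstein k r 4 I ∧
        hilb k r I 0 = 1 ∧ hilb k r I 1 = 10 ∧ hilb k r I 2 = 9 ∧
        hilb k r I 3 = 10 ∧ hilb k r I 4 = 1 := by
  refine ⟨fun m hm => ?_, ?_⟩
  · rintro ⟨r, I, -, hI, -, h1, h2, -, h4⟩
    exact not_gorenstein_of_hilb_eq hchar hm hI h1 h2 h4
  · rintro ⟨r, I, -, hI, -, h1, h2, -, h4⟩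
    exact not_gorenstein_of_hilb_eq (m := 2) hchar le_rfl hI h1 h2 h4
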